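/- arXiv:2010.00868 — 4 statements merged into one kernel-verified Lean document; each statement's English description precedes it below -/
import Mathlib

section
/- Let d ≥ 1 and let Φ : ℝ^d → ℝ be a differentiable function such that 0 < Φ(x) ≤ 1 for all x and |∇Φ(x)| ≤ C₁ Φ(x)^{3/2} for all x, for some constant C₁ > 0. Then for every x ∈ ℝ^d one has Φ(x)^{−1/2} ≤ Φ(0)^{−1/2} + (C₁/2)|x|. -/
/-- under (H1)-(H2), `Φ(x)^{-1/2} ≤ Φ(0)^{-1/2} + (C₁/2)|x|`. -/
theorem weight_inv_sqrt_growth (d : ℕ) (hd : 1 ≤ d)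
    (Φ : EuclideanSpace ℝ (Fin d) → ℝ) (hΦdiff : Differentiable ℝ Φ)
    (C₁ : ℝ) (hC₁ : 0 < C₁)
    (hΦpos : ∀ x, 0 < Φ x) (hΦle : ∀ x, Φ x ≤ 1)
    (hgrad : ∀ x, ‖gradient Φ x‖ ≤ C₁ * Φ x ^ ((3 : ℝ) / 2)) :
    ∀ x : EuclideanSpace ℝ (Fin d),
      Φ x ^ (-(1 : ℝ) / 2) ≤ Φ 0 ^ (-(1 : ℝ) / 2) + (C₁ / 2) * ‖x‖ := by
  intro x
  have hderiv (y : EuclideanSpace ℝ (Fin d)) :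
      HasFDerivAt (fun z => Φ z ^ (-(1 : ℝ) / 2))
        ((-(1 : ℝ) / 2 * Φ y ^ (-(1 : ℝ) / 2 - 1)) • fderiv ℝ Φ y) y :=
    (hΦdiff y).hasFDerivAt.rpow_const (Or.inl (hΦpos y).ne')
  have hbound (y : EuclideanSpace ℝ (Fin d)) :
      ‖(-(1 : ℝ) / 2 * Φ y ^ (-(1 : ℝ) / 2 - 1)) • fderiv ℝ Φ y‖ ≤ C₁ / 2 := by
    have hg : ‖fderiv ℝ Φ y‖ ≤ C₁ * Φ y ^ ((3 : ℝ) / 2) := by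
      simpa [gradient] using hgrad y
    have hpow : Φ y ^ (-(1 : ℝ) / 2 - 1) * Φ y ^ ((3 : ℝ) / 2) = 1 := by
      rw [← Real.rpow_add (hΦpos y)]
      norm_num
    have hnn : 0 ≤ Φ y ^ (-(1 : ℝ) / 2 - 1) := Real.rpow_nonneg (hΦpos y).le _
    have habs : ‖-(1 : ℝ) / 2 * Φ y ^ (-(1 : ℝ) / 2 - 1)‖ =
        1 / 2 * Φ y ^ (-(1 : ℝ) / 2 - 1) := by
      rw [norm_mul, Real.norm_of_nonneg hnn]
      norm_num
    rw [norm_smul, habs]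
    calc
      1 / 2 * Φ y ^ (-(1 : ℝ) / 2 - 1) * ‖fderiv ℝ Φ y‖
          ≤ 1 / 2 * Φ y ^ (-(1 : ℝ) / 2 - 1) * (C₁ * Φ y ^ ((3 : ℝ) / 2)) := by gcongr
      _ = C₁ / 2 * (Φ y ^ (-(1 : ℝ) / 2 - 1) * Φ y ^ ((3 : ℝ) / 2)) := by ring
      _ = C₁ / 2 := by rw [hpow, mul_one]
  have hmvt := convex_univ.norm_image_sub_le_of_norm_hasFDerivWithin_le
    (fun y _ => (hderiv y).hasFDerivWithinAt) (fun y _ => hbound y)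
    (Set.mem_univ 0) (Set.mem_univ x)
  rw [sub_zero] at hmvt
  linarith [(Real.le_norm_self _).trans hmvt]
end

section
/- Let d ≥ 1 and let Φ : ℝ^d → ℝ be a differentiable function such that 0 < Φ(x) ≤ 1 for all x and |∇Φ(x)| ≤ C₁ Φ(x)^{3/2} for all x, for some constant C₁ > 0. Then there exists a constant C₃ > 0 such that 1/(1+|x|)² ≤ C₃ Φ(x) for all x ∈ ℝ^d. -/
/-- If `f > 0` and `‖Df‖ ≤ C f ^ (3/2)`, then `f ^ (-1/2)` is Lipschitz with constant `C / 2`. -/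
theorem norm_rpow_neg_half_sub_le {E : Type*} [NormedAddCommGroup E] [NormedSpace ℝ E]
    {f : E → ℝ} (hf : Differentiable ℝ f) (hpos : ∀ x, 0 < f x) {C : ℝ}
    (hC : ∀ x, ‖fderiv ℝ f x‖ ≤ C * f x ^ ((3 : ℝ) / 2)) (x y : E) :
    ‖f y ^ (-(1 : ℝ) / 2) - f x ^ (-(1 : ℝ) / 2)‖ ≤ C / 2 * ‖y - x‖ := by
  refine convex_univ.norm_image_sub_le_of_norm_hasFDerivWithin_le
    (fun z _ ↦ ((hf z).hasFDerivAt.rpow_const (Or.inl (hpos z).ne')).hasFDerivWithinAt)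
    (fun z _ ↦ ?_) (Set.mem_univ x) (Set.mem_univ y)
  have hp : 0 < f z ^ (-(1 : ℝ) / 2 - 1) := Real.rpow_pos_of_pos (hpos z) _
  have hcancel : f z ^ (-(1 : ℝ) / 2 - 1) * f z ^ ((3 : ℝ) / 2) = 1 := by
    rw [← Real.rpow_add (hpos z)]
    norm_num
  rw [norm_smul, norm_mul, Real.norm_of_nonneg hp.le]
  calc ‖-(1 : ℝ) / 2‖ * f z ^ (-(1 : ℝ) / 2 - 1) * ‖fderiv ℝ f z‖
      ≤ ‖-(1 : ℝ) / 2‖ * f z ^ (-(1 : ℝ) / 2 - 1) * (C * f z ^ ((3 : ℝ) / 2)) := by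
        gcongr
        exact hC z
    _ = C / 2 * (f z ^ (-(1 : ℝ) / 2 - 1) * f z ^ ((3 : ℝ) / 2)) := by
        rw [show ‖-(1 : ℝ) / 2‖ = 1 / 2 by norm_num]
        ring
    _ = C / 2 := by rw [hcancel, mul_one]

/-- under (H1)-(H2), the weight decays at most quadratically:
`1/(1+|x|)² ≤ C₃ Φ(x)`. -/
theorem weight_lower_bound (d : ℕ) (hd : 1 ≤ d)
    (Φ : EuclideanSpace ℝ (Fin d) → ℝ) (hΦdiff : Differentiable ℝ Φ)
    (C₁ : ℝ) (hC₁ : 0 < C₁)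
    (hΦpos : ∀ x, 0 < Φ x) (hΦle : ∀ x, Φ x ≤ 1)
    (hgrad : ∀ x, ‖gradient Φ x‖ ≤ C₁ * Φ x ^ ((3 : ℝ) / 2)) :
    ∃ C₃ : ℝ, 0 < C₃ ∧ ∀ x : EuclideanSpace ℝ (Fin d),
      1 / (1 + ‖x‖) ^ 2 ≤ C₃ * Φ x := by
  have hfderiv : ∀ x, ‖fderiv ℝ Φ x‖ ≤ C₁ * Φ x ^ ((3 : ℝ) / 2) := fun x ↦ by
    simpa [gradient] using hgrad x
  have h0 : 0 < Φ 0 ^ (-(1 : ℝ) / 2) := Real.rpow_pos_of_pos (hΦpos 0) _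
  refine ⟨(Φ 0 ^ (-(1 : ℝ) / 2) + C₁ / 2) ^ 2, by positivity, fun x ↦ ?_⟩
  have hg : 0 < Φ x ^ (-(1 : ℝ) / 2) := Real.rpow_pos_of_pos (hΦpos x) _
  have hlip := (le_abs_self _).trans (norm_rpow_neg_half_sub_le hΦdiff hΦpos hfderiv 0 x)
  rw [sub_zero] at hlip
  have hle : Φ x ^ (-(1 : ℝ) / 2) ≤ (Φ 0 ^ (-(1 : ℝ) / 2) + C₁ / 2) * (1 + ‖x‖) := by
    nlinarith [mul_nonneg h0.le (norm_nonneg x)]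
  have hsq : (Φ x ^ (-(1 : ℝ) / 2)) ^ 2 * Φ x = 1 := by
    rw [← Real.rpow_natCast, ← Real.rpow_mul (hΦpos x).le, ← Real.rpow_add_one (hΦpos x).ne']
    norm_num
  rw [div_le_iff₀ (by positivity)]
  calc (1 : ℝ) = (Φ x ^ (-(1 : ℝ) / 2)) ^ 2 * Φ x := hsq.symm
    _ ≤ ((Φ 0 ^ (-(1 : ℝ) / 2) + C₁ / 2) * (1 + ‖x‖)) ^ 2 * Φ x := by
        have := (hΦpos x).le
        gcongr
    _ = (Φ 0 ^ (-(1 : ℝ) / 2) + C₁ / 2) ^ 2 * Φ x * (1 + ‖x‖) ^ 2 := by ring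
end

section
/- Let Φ : ℝ³ → ℝ be a differentiable function such that 0 < Φ(x) ≤ 1 for all x, |∇Φ(x)| ≤ C₁ Φ(x)^{3/2} for all x for some constant C₁ > 0, and such that Φ depends only on r = √(x₁² + x₂²), i.e. Φ(x₁,x₂,x₃) = Φ(x₁,x₂,0) for all (x₁,x₂,x₃) ∈ ℝ³ and Φ is invariant under rotations in the (x₁,x₂)-plane. Then there exists a constant C₃ > 0 such that 1/(1+r)² ≤ C₃ Φ(x) for all x ∈ ℝ³, where r = √(x₁² + x₂²). -/
/-- If `|∇Φ| ≤ C Φ^{3/2}` for a positive differentiable `Φ`, then `Φ^{-1/2}` is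
`C/2`-Lipschitz. -/
theorem abs_rpow_neg_half_sub_le_of_norm_gradient_le {E : Type*} [NormedAddCommGroup E]
    [InnerProductSpace ℝ E] [CompleteSpace E] {Φ : E → ℝ} (hdiff : Differentiable ℝ Φ)
    {C : ℝ} (hpos : ∀ x, 0 < Φ x)
    (hgrad : ∀ x, ‖gradient Φ x‖ ≤ C * Φ x ^ ((3 : ℝ) / 2)) (x y : E) :
    |Φ y ^ (-(1 / 2) : ℝ) - Φ x ^ (-(1 / 2) : ℝ)| ≤ C / 2 * ‖y - x‖ := by
  rw [← Real.norm_eq_abs]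
  refine convex_univ.norm_image_sub_le_of_norm_hasFDerivWithin_le
    (f := fun z => Φ z ^ (-(1 / 2) : ℝ)) (𝕜 := ℝ)
    (fun z _ => ((hdiff z).hasFDerivAt.rpow_const (Or.inl (hpos z).ne')).hasFDerivWithinAt)
    (fun z _ => ?_) (Set.mem_univ x) (Set.mem_univ y)
  have hnorm : ‖fderiv ℝ Φ z‖ ≤ C * Φ z ^ ((3 : ℝ) / 2) := by
    simpa [gradient] using hgrad z
  have hp : 0 < Φ z ^ (-(1 / 2) - 1 : ℝ) := Real.rpow_pos_of_pos (hpos z) _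
  have hcancel : Φ z ^ (-(1 / 2) - 1 : ℝ) * Φ z ^ ((3 : ℝ) / 2) = 1 := by
    rw [← Real.rpow_add (hpos z)]
    norm_num
  rw [norm_smul, Real.norm_eq_abs, abs_mul, abs_of_pos hp, abs_neg,
    abs_of_pos (by norm_num : (0 : ℝ) < 1 / 2)]
  calc 1 / 2 * Φ z ^ (-(1 / 2) - 1 : ℝ) * ‖fderiv ℝ Φ z‖
      ≤ 1 / 2 * Φ z ^ (-(1 / 2) - 1 : ℝ) * (C * Φ z ^ ((3 : ℝ) / 2)) := by gcongr
    _ = C / 2 * (Φ z ^ (-(1 / 2) - 1 : ℝ) * Φ z ^ ((3 : ℝ) / 2)) := by ring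
    _ = C / 2 := by rw [hcancel, mul_one]


/-- for a weight on `ℝ³` satisfying (H1)-(H2) that depends only on the
distance `r = √(x₁² + x₂²)` to the vertical axis, one has `1/(1+r)² ≤ C₃ Φ(x)`. -/
theorem weight_lower_bound_axisymmetric
    (Φ : EuclideanSpace ℝ (Fin 3) → ℝ) (hΦdiff : Differentiable ℝ Φ)
    (C₁ : ℝ) (hC₁ : 0 < C₁)
    (hΦpos : ∀ x, 0 < Φ x) (hΦle : ∀ x, Φ x ≤ 1)
    (hgrad : ∀ x, ‖gradient Φ x‖ ≤ C₁ * Φ x ^ ((3 : ℝ) / 2))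
    (hcyl : ∀ x y : EuclideanSpace ℝ (Fin 3),
      Real.sqrt ((x 0) ^ 2 + (x 1) ^ 2) = Real.sqrt ((y 0) ^ 2 + (y 1) ^ 2) → Φ x = Φ y) :
    ∃ C₃ : ℝ, 0 < C₃ ∧ ∀ x : EuclideanSpace ℝ (Fin 3),
      1 / (1 + Real.sqrt ((x 0) ^ 2 + (x 1) ^ 2)) ^ 2 ≤ C₃ * Φ x := by
  set M : ℝ := Φ 0 ^ (-(1 / 2) : ℝ) + C₁ / 2 with hM
  have hg₀ : 0 < Φ 0 ^ (-(1 / 2) : ℝ) := Real.rpow_pos_of_pos (hΦpos 0) _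
  have hMpos : 0 < M := by positivity
  refine ⟨M ^ 2, by positivity, fun x => ?_⟩
  set r := Real.sqrt ((x 0) ^ 2 + (x 1) ^ 2) with hr
  have hr₀ : 0 ≤ r := Real.sqrt_nonneg _
  set y : EuclideanSpace ℝ (Fin 3) := EuclideanSpace.single 0 r with hy
  have hxy : Φ x = Φ y := hcyl x y (by simp [hy, ← hr, Real.sqrt_sq hr₀])
  have hynorm : ‖y - 0‖ = r := by simp [hy, abs_of_nonneg hr₀]
  have hlip := (abs_le.1 <|
    abs_rpow_neg_half_sub_le_of_norm_gradient_le hΦdiff hΦpos hgrad 0 y).2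
  rw [hynorm, ← hxy] at hlip
  have hg : 0 < Φ x ^ (-(1 / 2) : ℝ) := Real.rpow_pos_of_pos (hΦpos x) _
  have hle : Φ x ^ (-(1 / 2) : ℝ) ≤ M * (1 + r) := by
    nlinarith [mul_nonneg hg₀.le hr₀]
  have hsq : (Φ x ^ (-(1 / 2) : ℝ)) ^ 2 * Φ x = 1 := by
    rw [← Real.rpow_natCast, ← Real.rpow_mul (hΦpos x).le]
    norm_num [Real.rpow_neg_one, (hΦpos x).ne']
  rw [div_le_iff₀ (by positivity)]
  calc 1 = (Φ x ^ (-(1 / 2) : ℝ)) ^ 2 * Φ x := hsq.symm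
    _ ≤ (M * (1 + r)) ^ 2 * Φ x := by
        have := (hΦpos x).le
        gcongr
    _ = M ^ 2 * Φ x * (1 + r) ^ 2 := by ring
end

section
/- Let 0 ≤ γ ≤ 2 and define Φ : ℝ³ → ℝ by Φ(x₁,x₂,x₃) = (1+r)^{−γ} where r = √(x₁² + x₂²). Then for every x ∈ ℝ³ with (x₁,x₂) ≠ (0,0), Φ is differentiable at x and |∇Φ(x)| ≤ γ · Φ(x)^{3/2}. -/
/-- The distance to the vertical axis in `ℝ³` is `1`-Lipschitz. -/
theorem lipschitzWith_sqrt_sq_add_sq :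
    LipschitzWith 1 (fun y : EuclideanSpace ℝ (Fin 3) => Real.sqrt ((y 0) ^ 2 + (y 1) ^ 2)) := by
  refine LipschitzWith.of_dist_le_mul fun y z => ?_
  have hr (w : EuclideanSpace ℝ (Fin 3)) :
      Real.sqrt ((w 0) ^ 2 + (w 1) ^ 2) = ‖!₂[w 0, w 1]‖ := by
    simp [EuclideanSpace.norm_eq, Fin.sum_univ_two]
  have hsub : !₂[y 0, y 1] - !₂[z 0, z 1] = !₂[(y - z) 0, (y - z) 1] := by
    ext i
    fin_cases i <;> simp
  rw [hr, hr, Real.dist_eq, NNReal.coe_one, one_mul, dist_eq_norm]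
  refine (abs_norm_sub_norm_le _ _).trans ?_
  rw [hsub, ← hr, EuclideanSpace.norm_eq]
  refine Real.sqrt_le_sqrt ?_
  simp only [Fin.sum_univ_three, Real.norm_eq_abs, sq_abs]
  linarith [sq_nonneg ((y - z) 2)]

/-- The distance to the vertical axis in `ℝ³` is differentiable away from the axis. -/
theorem differentiableAt_sqrt_sq_add_sq (x : EuclideanSpace ℝ (Fin 3))
    (hx : ¬(x 0 = 0 ∧ x 1 = 0)) :
    DifferentiableAt ℝ
      (fun y : EuclideanSpace ℝ (Fin 3) => Real.sqrt ((y 0) ^ 2 + (y 1) ^ 2)) x := by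
  refine DifferentiableAt.sqrt (by fun_prop) fun h => hx ?_
  constructor <;> nlinarith [sq_nonneg (x 0), sq_nonneg (x 1)]


/-- the cylindrical weight `Φ(x) = (1+r)^{-γ}` on `ℝ³`, where
`r = √(x₁² + x₂²)` and `0 ≤ γ ≤ 2`, satisfies (H2) with constant `C₁ = γ` away from
the vertical axis: it is differentiable there and `|∇Φ(x)| ≤ γ Φ(x)^{3/2}`. -/
theorem cylindrical_weight_H2 (γ : ℝ) (hγ0 : 0 ≤ γ) (hγ2 : γ ≤ 2) :
    ∀ x : EuclideanSpace ℝ (Fin 3), ¬(x 0 = 0 ∧ x 1 = 0) →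
      DifferentiableAt ℝ
        (fun y : EuclideanSpace ℝ (Fin 3) =>
          (1 + Real.sqrt ((y 0) ^ 2 + (y 1) ^ 2)) ^ (-γ)) x ∧
      ‖gradient (fun y : EuclideanSpace ℝ (Fin 3) =>
          (1 + Real.sqrt ((y 0) ^ 2 + (y 1) ^ 2)) ^ (-γ)) x‖ ≤
        γ * ((1 + Real.sqrt ((x 0) ^ 2 + (x 1) ^ 2)) ^ (-γ)) ^ ((3 : ℝ) / 2) := by
  intro x hx
  have hpos : 0 < 1 + Real.sqrt ((x 0) ^ 2 + (x 1) ^ 2) := by positivity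
  have hderiv := ((differentiableAt_sqrt_sq_add_sq x hx).hasFDerivAt.const_add 1).rpow_const
    (p := -γ) (Or.inl hpos.ne')
  refine ⟨hderiv.differentiableAt, ?_⟩
  rw [gradient, LinearIsometryEquiv.norm_map, hderiv.fderiv, norm_smul, norm_mul, norm_neg,
    Real.norm_of_nonneg hγ0, Real.norm_of_nonneg (Real.rpow_nonneg hpos.le _),
    ← Real.rpow_mul hpos.le, mul_assoc]
  refine mul_le_mul_of_nonneg_left ?_ hγ0
  calc _ ≤ (1 + Real.sqrt ((x 0) ^ 2 + (x 1) ^ 2)) ^ (-γ - 1) * 1 := by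
        gcongr
        exact norm_fderiv_le_of_lipschitz ℝ lipschitzWith_sqrt_sq_add_sq
    _ ≤ _ := by
        rw [mul_one]
        exact Real.rpow_le_rpow_of_exponent_le (by simp) (by linarith)
end
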